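/- Consider a (possibly non-developable) bird's-foot degree-4 rigid origami vertex: sector angles with α₁ = α₂ ∈ (0, π) and α₃ = α₄ ∈ (0, π). If (ρ₁, ρ₂, ρ₃, ρ₄) with every ρⱼ ∈ (−π, π) satisfies the rotation-matrix closure condition, then tan²(ρ₁/2) = tan²(ρ₃/2) and sin α₁ · cos(ρ₂/2) = sin α₃ · cos(ρ₄/2). -/

import Mathlib

open Real Matrix

/-- Rotation of ℝ³ by angle `β` about the x-axis. -/
noncomputable def Rx (β : ℝ) : Matrix (Fin 3) (Fin 3) ℝ :=
  !![1, 0, 0;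
     0, Real.cos β, -Real.sin β;
     0, Real.sin β, Real.cos β]

/-- Rotation of ℝ³ by angle `β` about the z-axis. -/
noncomputable def Rz (β : ℝ) : Matrix (Fin 3) (Fin 3) ℝ :=
  !![Real.cos β, -Real.sin β, 0;
     Real.sin β, Real.cos β, 0;
     0, 0, 1]

/-- The spherical-linkage loop (closure) condition for a degree-4 origami vertex with
sector angles `α₁, α₂, α₃, α₄` and folding angles `ρ₁, ρ₂, ρ₃, ρ₄`. -/
def ClosureCond (α₁ α₂ α₃ α₄ ρ₁ ρ₂ ρ₃ ρ₄ : ℝ) : Prop :=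
  Rx ρ₁ * Rz α₁ * Rx ρ₂ * Rz α₂ * Rx ρ₃ * Rz α₃ * Rx ρ₄ * Rz α₄ = 1

/-- Closure condition, `Fin 4`-indexed version (index `j` ↔ paper index `j+1`). -/
def ClosureCondF (α ρ : Fin 4 → ℝ) : Prop :=
  ClosureCond (α 0) (α 1) (α 2) (α 3) (ρ 0) (ρ 1) (ρ 2) (ρ 3)

lemma Rx_inv (p : ℝ) : Rx (-p) * Rx p = 1 := by
  have h := Real.sin_sq_add_cos_sq p
  ext i j
  fin_cases i <;> fin_cases j <;>
    simp [Rx, Matrix.mul_apply, Fin.sum_univ_three] <;> nlinarith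

lemma Rx_tr (p : ℝ) : Rx p * (Rx p)ᵀ = 1 := by
  have h := Real.sin_sq_add_cos_sq p
  ext i j
  fin_cases i <;> fin_cases j <;>
    simp [Rx, Matrix.mul_apply, Fin.sum_univ_three] <;> nlinarith

lemma Rz_tr (p : ℝ) : Rz p * (Rz p)ᵀ = 1 := by
  have h := Real.sin_sq_add_cos_sq p
  ext i j
  fin_cases i <;> fin_cases j <;>
    simp [Rz, Matrix.mul_apply, Fin.sum_univ_three] <;> nlinarith

lemma tr_mul {A B : Matrix (Fin 3) (Fin 3) ℝ} (hA : A * Aᵀ = 1) (hB : B * Bᵀ = 1) :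
    (A * B) * (A * B)ᵀ = 1 := by
  rw [Matrix.transpose_mul, Matrix.mul_assoc, ← Matrix.mul_assoc B, hB, Matrix.one_mul, hA]

lemma entry_eq (p q : ℝ) (A B : Matrix (Fin 3) (Fin 3) ℝ) (hB : B * Bᵀ = 1)
    (h : Rx p * A * Rx q * B = 1) : A 0 0 = B 0 0 := by
  have e : A * Rx q = Rx (-p) * Bᵀ := by
    calc A * Rx q = (Rx (-p) * Rx p) * A * Rx q * (B * Bᵀ) := by simp [Rx_inv, hB]
      _ = Rx (-p) * (Rx p * A * Rx q * B) * Bᵀ := by simp only [Matrix.mul_assoc]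
      _ = _ := by rw [h, Matrix.mul_one]
  have := congrFun (congrFun e 0) 0
  simpa [Matrix.mul_apply, Fin.sum_univ_three, Rx] using this

lemma entry_zxz (x y z : ℝ) : (Rz x * Rx y * Rz z) 0 0 =
    Real.cos x * Real.cos z - Real.sin x * Real.sin z * Real.cos y := by
  simp [Matrix.mul_apply, Fin.sum_univ_three, Rx, Rz]
  ring

lemma key (a b c d p q r s : ℝ) (h : ClosureCond a b c d p q r s) :
    Real.cos a * Real.cos b - Real.sin a * Real.sin b * Real.cos q =
    Real.cos c * Real.cos d - Real.sin c * Real.sin d * Real.cos s := by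
  rw [← entry_zxz, ← entry_zxz]
  refine entry_eq p r _ _ (tr_mul (tr_mul (Rz_tr _) (Rx_tr _)) (Rz_tr _)) ?_
  rw [← h]
  simp only [Matrix.mul_assoc]

lemma cyc (a b c d p q r s : ℝ) (h : ClosureCond a b c d p q r s) :
    ClosureCond b c d a q r s p := by
  unfold ClosureCond at *
  have h' : (Rx p * Rz a) * (Rx q * Rz b * Rx r * Rz c * Rx s * Rz d) = 1 := by
    rw [← h]; simp only [Matrix.mul_assoc]
  have := mul_eq_one_comm.mp h'
  rw [← this]; simp only [Matrix.mul_assoc]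

/-- Eq. (8): folding-angle congruences for a (possibly non-developable)
bird's-foot degree-4 vertex. -/
theorem birds_foot_congruences (α₁ α₂ α₃ α₄ ρ₁ ρ₂ ρ₃ ρ₄ : ℝ)
    (hα₁ : α₁ ∈ Set.Ioo 0 π) (hα₃ : α₃ ∈ Set.Ioo 0 π)
    (h12 : α₁ = α₂) (h34 : α₃ = α₄)
    (hρ₁ : ρ₁ ∈ Set.Ioo (-π) π) (hρ₂ : ρ₂ ∈ Set.Ioo (-π) π)
    (hρ₃ : ρ₃ ∈ Set.Ioo (-π) π) (hρ₄ : ρ₄ ∈ Set.Ioo (-π) π)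
    (hclose : ClosureCond α₁ α₂ α₃ α₄ ρ₁ ρ₂ ρ₃ ρ₄) :
    Real.tan (ρ₁ / 2) ^ 2 = Real.tan (ρ₃ / 2) ^ 2 ∧
    Real.sin α₁ * Real.cos (ρ₂ / 2) = Real.sin α₃ * Real.cos (ρ₄ / 2) := by
  subst h12 h34
  have k1 := key _ _ _ _ _ _ _ _ hclose
  have k2 := key _ _ _ _ _ _ _ _ (cyc _ _ _ _ _ _ _ _ hclose)
  have s1 := Real.sin_pos_of_mem_Ioo hα₁
  have s3 := Real.sin_pos_of_mem_Ioo hα₃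
  have hc : ∀ x ∈ Set.Ioo (-π) π, 0 < Real.cos (x / 2) := fun x hx =>
    Real.cos_pos_of_mem_Ioo ⟨by linarith [hx.1], by linarith [hx.2]⟩
  have dbl : ∀ x : ℝ, Real.cos x = 2 * Real.cos (x / 2) ^ 2 - 1 := fun x => by
    rw [← Real.cos_two_mul]; congr 1; ring
  have c1 := hc _ hρ₁
  have c2 := hc _ hρ₂
  have c3 := hc _ hρ₃
  have c4 := hc _ hρ₄
  constructor
  · have e : Real.cos ρ₃ = Real.cos ρ₁ := by
      have : (Real.sin α₁ * Real.sin α₃) * Real.cos ρ₃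
          = (Real.sin α₁ * Real.sin α₃) * Real.cos ρ₁ := by linarith
      exact mul_left_cancel₀ (mul_pos s1 s3).ne' this
    have e2 : Real.cos (ρ₁ / 2) ^ 2 = Real.cos (ρ₃ / 2) ^ 2 := by
      linarith [dbl ρ₁, dbl ρ₃]
    rw [Real.tan_eq_sin_div_cos, Real.tan_eq_sin_div_cos, div_pow, div_pow, Real.sin_sq,
      Real.sin_sq, e2]
  · rw [dbl ρ₂, dbl ρ₄] at k1
    have q1 := Real.sin_sq_add_cos_sq α₁
    have q3 := Real.sin_sq_add_cos_sq α₃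
    have : (Real.sin α₁ * Real.cos (ρ₂ / 2)) ^ 2 = (Real.sin α₃ * Real.cos (ρ₄ / 2)) ^ 2 := by
      linarith
    exact (sq_eq_sq₀ (mul_pos s1 c2).le (mul_pos s3 c4).le).mp this
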